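/- (Proposition 5.1.) Let c, c_T, δ > 0 and t < T with arctan(2c_T·√(δ/c)) + 2(T−t)·√(δc) < π/2, and let z(s,x) = β(s)·|x|²/2 + μ(s), where β(s) = 2√(c/δ)·tan(arctan(2c_T·√(δ/c)) + 2√(δc)·(T−s)) and μ(s) = 2c_T + ∫_s^T [2c + (1/2)·β(τ)·tr(a)] dτ. Let H : [t,T]×ℝⁿ×ℝⁿ → ℝ and f : [t,T]×ℝⁿ → ℝ satisfy |H(s,x,p)| ≤ c(1+|x|²) + (δ/2)|p|² and |f(s,x)| ≤ c(1+|x|²), and let h, f_T : ℝⁿ → ℝ satisfy |h(x)| ≤ c_T(1+|x|²) and |f_T(x)| ≤ c_T(1+|x|²). Suppose V : [t,T]×ℝⁿ → ℝ is continuous, C¹ in s and C² in x on [t,T)×ℝⁿ, solves −∂_s V(s,x) + 𝒜V(s,x) = H(s,x,DV(s,x)) + f(s,x) on [t,T)×ℝⁿ with V(T,x) = h(x) + f_T(x), and satisfies the conditions at infinity limsup_{R→∞} sup_{s∈[t,T], |x|≥R} (V(s,x) − z(s,x)) ≤ 0 and liminf_{R→∞} inf_{s∈[t,T], |x|≥R}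 (V(s,x) + z(s,x)) ≥ 0. Then −z(s,x) ≤ V(s,x) ≤ z(s,x) for all (s,x) ∈ [t,T]×ℝⁿ. -/

import Mathlib

open Real MeasureTheory Matrix

noncomputable section

abbrev Euc (n : ℕ) := EuclideanSpace ℝ (Fin n)

/-- Second partial derivative `∂²φ/(∂x_i ∂x_j)(x)`. -/
def secondPartial (n : ℕ) (φ : Euc n → ℝ) (x : Euc n) (i j : Fin n) : ℝ :=
  fderiv ℝ (fun y => fderiv ℝ φ y (EuclideanSpace.single j 1)) x (EuclideanSpace.single i 1)

/-- The operator `𝒜φ(x) = −(1/2)·∑_{i,j} a_{ij}·∂²φ/(∂x_i∂x_j)(x)`. -/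
def opA (n : ℕ) (a : Matrix (Fin n) (Fin n) ℝ) (φ : Euc n → ℝ) (x : Euc n) : ℝ :=
  -(1 / 2) * ∑ i, ∑ j, a i j * secondPartial n φ x i j

theorem secondPartial_eq {n : ℕ} {φ : Euc n → ℝ} (hφ : ContDiff ℝ 2 φ) (x : Euc n)
    (i j : Fin n) :
    secondPartial n φ x i j =
      fderiv ℝ (fderiv ℝ φ) x (EuclideanSpace.single i 1) (EuclideanSpace.single j 1) := by
  have hd : DifferentiableAt ℝ (fderiv ℝ φ) x :=
    (hφ.fderiv_right (m := 1) (by norm_num)).differentiable (by norm_num) x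
  unfold secondPartial
  rw [fderiv_clm_apply hd (differentiableAt_const _)]
  simp

theorem fderiv_fderiv_apply_self_nonpos {E : Type*} [NormedAddCommGroup E] [NormedSpace ℝ E]
    {φ : E → ℝ} (hφ : ContDiff ℝ 2 φ) {x : E} (hx : IsLocalMax φ x) (v : E) :
    fderiv ℝ (fderiv ℝ φ) x v v ≤ 0 := by
  have hdφ : Differentiable ℝ φ := hφ.differentiable (by norm_num)
  have hd : Differentiable ℝ (fderiv ℝ φ) :=
    (hφ.fderiv_right (m := 1) (by norm_num)).differentiable (by norm_num)
  let ℓ : ℝ → E := fun r => x + r • v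
  have hℓ : ∀ r, HasDerivAt ℓ v r := fun r => by
    exact (((hasDerivAt_id r).smul_const v).const_add x).congr_deriv (one_smul ℝ v)
  have hℓ0 : ℓ 0 = x := by simp [ℓ]
  have h1 : deriv (φ ∘ ℓ) = fun r => fderiv ℝ φ (ℓ r) v := funext fun r =>
    ((hdφ (ℓ r)).hasFDerivAt.comp_hasDerivAt r (hℓ r)).deriv
  have h2 : deriv (deriv (φ ∘ ℓ)) 0 = fderiv ℝ (fderiv ℝ φ) x v v := by
    rw [h1]
    have := (((hd (ℓ 0)).hasFDerivAt.comp_hasDerivAt (0 : ℝ) (hℓ 0)).clm_apply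
      (hasDerivAt_const (0 : ℝ) v)).deriv
    simpa [hℓ0] using this
  have hmax : IsLocalMax (φ ∘ ℓ) 0 := by
    have ht : Filter.Tendsto ℓ (nhds 0) (nhds x) := by
      simpa [hℓ0] using (hℓ 0).continuousAt.tendsto
    have := ht.eventually hx
    simpa [IsLocalMax, IsMaxFilter, hℓ0] using this
  by_contra! hpos
  rw [← h2] at hpos
  have hmin : IsLocalMin (φ ∘ ℓ) 0 :=
    isLocalMin_of_deriv_deriv_pos hpos hmax.deriv_eq_zero
      (hdφ.continuous.continuousAt.comp (hℓ 0).continuousAt)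
  have hconst : (φ ∘ ℓ) =ᶠ[nhds 0] fun _ => (φ ∘ ℓ) 0 := by
    filter_upwards [hmax, hmin] with r h₁ h₂ using le_antisymm h₁ h₂
  have : deriv (deriv (φ ∘ ℓ)) 0 = 0 := by
    rw [hconst.deriv.deriv_eq]
    simp
  linarith

theorem opA_nonneg_of_isLocalMax {n : ℕ} (σM : Matrix (Fin n) (Fin n) ℝ) {φ : Euc n → ℝ}
    (hφ : ContDiff ℝ 2 φ) {x : Euc n} (hx : IsLocalMax φ x) :
    0 ≤ opA n (σM * σMᵀ) φ x := by
  have key : ∑ i, ∑ j, (σM * σMᵀ) i j * secondPartial n φ x i j =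
      ∑ k, fderiv ℝ (fderiv ℝ φ) x (∑ i, σM i k • EuclideanSpace.single i 1)
        (∑ j, σM j k • EuclideanSpace.single j 1) := by
    simp only [secondPartial_eq hφ, Matrix.mul_apply, Matrix.transpose_apply, map_sum, map_smul,
      _root_.sum_apply, _root_.smul_apply, smul_eq_mul, Finset.sum_mul, Finset.mul_sum]
    rw [Finset.sum_comm_cycle]
    refine Finset.sum_congr rfl fun k _ => Finset.sum_comm.trans ?_
    refine Finset.sum_congr rfl fun i _ => Finset.sum_congr rfl fun j _ => ?_
    ring
  have : ∑ i, ∑ j, (σM * σMᵀ) i j * secondPartial n φ x i j ≤ 0 := by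
    rw [key]
    exact Finset.sum_nonpos fun k _ => fderiv_fderiv_apply_self_nonpos hφ hx _
  unfold opA
  linarith

theorem opA_sub {n : ℕ} (a : Matrix (Fin n) (Fin n) ℝ) {φ ψ : Euc n → ℝ}
    (hφ : ContDiff ℝ 2 φ) (hψ : ContDiff ℝ 2 ψ) (x : Euc n) :
    opA n a (fun y => φ y - ψ y) x = opA n a φ x - opA n a ψ x := by
  have hd : ∀ {χ : Euc n → ℝ}, ContDiff ℝ 2 χ → DifferentiableAt ℝ (fderiv ℝ χ) x := fun hχ =>
    (hχ.fderiv_right (m := 1) (by norm_num)).differentiable (by norm_num) x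
  have h1 : fderiv ℝ (fun y => φ y - ψ y) = fun y => fderiv ℝ φ y - fderiv ℝ ψ y :=
    funext fun y => fderiv_fun_sub (hφ.differentiable (by norm_num) y)
      (hψ.differentiable (by norm_num) y)
  have h2 : ∀ i j, secondPartial n (fun y => φ y - ψ y) x i j =
      secondPartial n φ x i j - secondPartial n ψ x i j := fun i j => by
    rw [secondPartial_eq (hφ.sub hψ), secondPartial_eq hφ, secondPartial_eq hψ, h1,
      fderiv_fun_sub (hd hφ) (hd hψ)]
    rfl
  simp only [opA, h2, mul_sub, Finset.sum_sub_distrib]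

theorem opA_neg {n : ℕ} (a : Matrix (Fin n) (Fin n) ℝ) (φ : Euc n → ℝ) (x : Euc n) :
    opA n a (fun y => -φ y) x = -opA n a φ x := by
  simp [opA, secondPartial, fderiv_fun_neg]

theorem contDiff_quadratic {n : ℕ} (b m : ℝ) :
    ContDiff ℝ 2 fun x : Euc n => b * ‖x‖ ^ 2 / 2 + m :=
  ((contDiff_const.mul (contDiff_norm_sq ℝ)).div_const 2).add contDiff_const

theorem hasFDerivAt_quadratic {n : ℕ} (b m : ℝ) (x : Euc n) :
    HasFDerivAt (fun x : Euc n => b * ‖x‖ ^ 2 / 2 + m) (b • innerSL ℝ x) x := by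
  have h := (((hasStrictFDerivAt_norm_sq x).hasFDerivAt.const_mul (b / 2)).add_const m)
  have heq : (fun x : Euc n => b * ‖x‖ ^ 2 / 2 + m) = fun x => b / 2 * ‖x‖ ^ 2 + m :=
    funext fun y => by ring
  rw [heq]
  refine h.congr_fderiv ?_
  ext v
  simp
  ring

theorem opA_quadratic {n : ℕ} (a : Matrix (Fin n) (Fin n) ℝ) (b m : ℝ) (x : Euc n) :
    opA n a (fun x => b * ‖x‖ ^ 2 / 2 + m) x = -(1 / 2) * (b * a.trace) := by
  have h1 : fderiv ℝ (fun x : Euc n => b * ‖x‖ ^ 2 / 2 + m) = fun x => b • innerSL ℝ x :=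
    funext fun x => (hasFDerivAt_quadratic b m x).fderiv
  have h2 : ∀ i j, secondPartial n (fun x => b * ‖x‖ ^ 2 / 2 + m) x i j =
      if i = j then b else 0 := fun i j => by
    have h3 : HasFDerivAt (fun y : Euc n => b * y j)
        (b • (EuclideanSpace.proj j : Euc n →L[ℝ] ℝ)) x :=
      (EuclideanSpace.proj j : Euc n →L[ℝ] ℝ).hasFDerivAt.const_mul b
    have h4 : (fun y => fderiv ℝ (fun x : Euc n => b * ‖x‖ ^ 2 / 2 + m) y
        (EuclideanSpace.single j 1)) = fun y => b * y j := by
      rw [h1]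
      ext y
      simp [EuclideanSpace.inner_single_right]
    rw [secondPartial, h4, h3.fderiv]
    simp [eq_comm]
  simp only [opA, h2, mul_ite, mul_zero, Finset.sum_ite_eq, Finset.mem_univ, if_true,
    Matrix.trace, Matrix.diag, Finset.mul_sum]
  exact Finset.sum_congr rfl fun i _ => by ring

/-- Maximum principle for `-∂_s + 𝒜` on `[t,T] × ℝⁿ`, where the differential inequality is only
required at spatially critical points. -/
theorem nonpos_of_parabolic_subsolution {n : ℕ} (σM : Matrix (Fin n) (Fin n) ℝ) {t T : ℝ}
    {w : ℝ → Euc n → ℝ}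
    (hcont : ContinuousOn (fun p : ℝ × Euc n => w p.1 p.2) (Set.Icc t T ×ˢ Set.univ))
    (hdiff : ∀ x : Euc n, ∀ s ∈ Set.Ico t T, DifferentiableAt ℝ (fun r => w r x) s)
    (hC2 : ∀ s ∈ Set.Ico t T, ContDiff ℝ 2 (w s))
    (hsub : ∀ s ∈ Set.Ico t T, ∀ x : Euc n, fderiv ℝ (w s) x = 0 →
      -(deriv (fun r => w r x) s) + opA n (σM * σMᵀ) (w s) x ≤ 0)
    (hterm : ∀ x : Euc n, w T x ≤ 0)
    (hinf : ∀ ε > (0 : ℝ), ∃ R : ℝ, ∀ s ∈ Set.Icc t T, ∀ x : Euc n, R ≤ ‖x‖ → w s x ≤ ε) :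
    ∀ s ∈ Set.Icc t T, ∀ x : Euc n, w s x ≤ 0 := by
  intro s₀ hs₀ x₀
  by_contra! hpos
  obtain ⟨η, hη, hη'⟩ : ∃ η > 0, η * (T - s₀) ≤ w s₀ x₀ / 2 := by
    refine ⟨w s₀ x₀ / 2 / (T - s₀ + 1), div_pos (by linarith) (by linarith [hs₀.2]), ?_⟩
    rw [div_mul_eq_mul_div, div_le_iff₀ (by linarith [hs₀.2])]
    nlinarith [hs₀.2]
  obtain ⟨R, hR⟩ := hinf (w s₀ x₀ / 4) (by linarith)
  let g : ℝ × Euc n → ℝ := fun p => w p.1 p.2 - η * (T - p.1)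
  let K : Set (ℝ × Euc n) := Set.Icc t T ×ˢ Metric.closedBall 0 (max R ‖x₀‖)
  have hK : IsCompact K := isCompact_Icc.prod (isCompact_closedBall _ _)
  have hgK : ContinuousOn g K :=
    (hcont.mono (Set.prod_mono_right (Set.subset_univ _))).sub (by fun_prop)
  have h0 : (s₀, x₀) ∈ K := ⟨hs₀, by simp⟩
  obtain ⟨⟨s, x⟩, ⟨hs, -⟩, hmaxK⟩ := hK.exists_isMaxOn ⟨_, h0⟩ hgK
  have hg0 : w s₀ x₀ / 2 ≤ g (s, x) := le_trans (by simp only [g]; linarith) (hmaxK h0)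
  have hmax : ∀ r ∈ Set.Icc t T, ∀ y : Euc n, g (r, y) ≤ g (s, x) := by
    intro r hr y
    by_cases hy : R ≤ ‖y‖
    · have h1 := hR r hr y hy
      have h2 := mul_nonneg hη.le (sub_nonneg.2 hr.2)
      simp only [g] at hg0 ⊢
      linarith
    · exact hmaxK (show (r, y) ∈ K from
        ⟨hr, by simpa using Or.inl (not_le.1 hy).le⟩)
  have hsT : s < T := by
    refine lt_of_le_of_ne hs.2 fun h => ?_
    subst h
    have := hterm x
    simp only [g, sub_self, mul_zero] at hg0
    linarith
  have hs' : s ∈ Set.Ico t T := ⟨hs.1, hsT⟩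
  have hxmax : IsLocalMax (w s) x := Filter.Eventually.of_forall fun y => by
    have := hmax s hs y
    simp only [g] at this
    linarith
  have hds : deriv (fun r => w r x) s ≤ -η := by
    have hd : HasDerivAt (fun r => g (r, x)) (deriv (fun r => w r x) s + η) s := by
      have h1 := ((hasDerivAt_id s).const_sub T).const_mul η
      exact ((hdiff x s hs').hasDerivAt.sub h1).congr_deriv (by ring)
    have h2 : Filter.Tendsto (slope (fun r => g (r, x)) s) (nhdsWithin s (Set.Ioi s))
        (nhds (deriv (fun r => w r x) s + η)) :=
      (hasDerivAt_iff_tendsto_slope.1 hd).mono_left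
        (nhdsWithin_mono _ fun r hr => ne_of_gt hr)
    have h3 := le_of_tendsto h2 (b := 0) (by
      filter_upwards [Ioo_mem_nhdsGT hsT] with r hr
      rw [slope_def_field]
      exact div_nonpos_of_nonpos_of_nonneg
        (sub_nonpos.2 (hmax r ⟨hs.1.trans hr.1.le, hr.2.le⟩ x)) (sub_nonneg.2 hr.1.le))
    linarith
  have h1 := hsub s hs' x hxmax.fderiv_eq_zero
  have h2 := opA_nonneg_of_isLocalMax σM (hC2 s hs') hxmax
  linarith

theorem hasDerivAt_riccati_tan {c δ A T s : ℝ} (hc : 0 < c) (hδ : 0 < δ)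
    (hcos : cos (A + 2 * √(δ * c) * (T - s)) ≠ 0) :
    HasDerivAt (fun s => 2 * √(c / δ) * tan (A + 2 * √(δ * c) * (T - s)))
      (-(4 * c + δ * (2 * √(c / δ) * tan (A + 2 * √(δ * c) * (T - s))) ^ 2)) s := by
  have h1 : HasDerivAt (fun s => A + 2 * √(δ * c) * (T - s)) (-(2 * √(δ * c))) s := by
    simpa using (((hasDerivAt_id s).const_sub T).const_mul (2 * √(δ * c))).const_add A
  have h2 := ((Real.hasDerivAt_tan hcos).comp s h1).const_mul (2 * √(c / δ))
  refine h2.congr_deriv ?_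
  have h3 : √(c / δ) * √(δ * c) = c := by
    rw [← Real.sqrt_mul (by positivity), show c / δ * (δ * c) = c * c by field_simp,
      Real.sqrt_mul_self hc.le]
  have h4 : √(c / δ) ^ 2 * δ = c := by
    rw [Real.sq_sqrt (by positivity)]
    field_simp
  have h5 : 1 / cos (A + 2 * √(δ * c) * (T - s)) ^ 2 =
      1 + tan (A + 2 * √(δ * c) * (T - s)) ^ 2 := by
    rw [Real.tan_eq_sin_div_cos]
    field_simp
    linarith [Real.sin_sq_add_cos_sq (A + 2 * √(δ * c) * (T - s))]
  rw [h5]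
  linear_combination (4 * tan (A + 2 * √(δ * c) * (T - s)) ^ 2) * h4 -
    4 * (1 + tan (A + 2 * √(δ * c) * (T - s)) ^ 2) * h3

theorem hasDerivAt_integral_left {F : ℝ → ℝ} {O : Set ℝ} (hO : IsOpen O) {s T : ℝ} (hsT : s ≤ T)
    (hF : ∀ r ∈ O, ContinuousAt F r) (hsub : Set.Icc s T ⊆ O) :
    HasDerivAt (fun r => ∫ τ in r..T, F τ) (-F s) s := by
  have hs : s ∈ O := hsub ⟨le_rfl, hsT⟩
  refine intervalIntegral.integral_hasDerivAt_left ?_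
    (ContinuousAt.stronglyMeasurableAtFilter hO hF s hs) (hF s hs)
  refine ContinuousOn.intervalIntegrable fun r hr => (hF r (hsub ?_)).continuousWithinAt
  rwa [Set.uIcc_of_le hsT] at hr

/-- The majorant `z` solves `-∂_s z + 𝒜z = 2c(1+|x|²) + (δ/2)|Dz|²`, hence dominates every
subsolution `U` of this equation that lies below `2c_T(1+|x|²)` at the terminal time. -/
theorem subsolution_le_majorant
    {n : ℕ} (σM : Matrix (Fin n) (Fin n) ℝ) {c cT δ t T : ℝ} (hc : 0 < c) (hcT : 0 < cT)
    (hδ : 0 < δ)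
    (hsmall : arctan (2 * cT * √(δ / c)) + (T - t) * (2 * √(δ * c)) < π / 2)
    {β μ : ℝ → ℝ} {z : ℝ → Euc n → ℝ}
    (hβ : ∀ s, β s = 2 * √(c / δ) *
      tan (arctan (2 * cT * √(δ / c)) + 2 * √(δ * c) * (T - s)))
    (hμ : ∀ s, μ s = 2 * cT + ∫ τ in s..T, (2 * c + (1 / 2) * β τ * (σM * σMᵀ).trace))
    (hz : ∀ s x, z s x = β s * ‖x‖ ^ 2 / 2 + μ s)
    {U : ℝ → Euc n → ℝ}
    (hcont : ContinuousOn (fun p : ℝ × Euc n => U p.1 p.2) (Set.Icc t T ×ˢ Set.univ))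
    (hdiff : ∀ x : Euc n, ∀ s ∈ Set.Ico t T, DifferentiableAt ℝ (fun r => U r x) s)
    (hC2 : ∀ s ∈ Set.Ico t T, ContDiff ℝ 2 (U s))
    (hsub : ∀ s ∈ Set.Ico t T, ∀ x : Euc n,
      -(deriv (fun r => U r x) s) + opA n (σM * σMᵀ) (U s) x ≤
        2 * c * (1 + ‖x‖ ^ 2) + δ / 2 * ‖gradient (U s) x‖ ^ 2)
    (hterm : ∀ x : Euc n, U T x ≤ 2 * cT * (1 + ‖x‖ ^ 2))
    (hinf : ∀ ε > (0 : ℝ), ∃ R : ℝ, ∀ s ∈ Set.Icc t T, ∀ x : Euc n, R ≤ ‖x‖ →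
      U s x - z s x ≤ ε) :
    ∀ s ∈ Set.Icc t T, ∀ x : Euc n, U s x ≤ z s x := by
  set A := arctan (2 * cT * √(δ / c)) with hA
  have hA0 : 0 < A := Real.arctan_pos.2 (by positivity)
  let θ : ℝ → ℝ := fun s => A + 2 * √(δ * c) * (T - s)
  have hθ : Continuous θ := by fun_prop
  let O : Set ℝ := θ ⁻¹' Set.Ioo (-(π / 2)) (π / 2)
  have hO : IsOpen O := isOpen_Ioo.preimage hθ
  have hIcc : Set.Icc t T ⊆ O := fun s hs => by
    have h1 : 0 ≤ 2 * √(δ * c) * (T - s) := mul_nonneg (by positivity) (sub_nonneg.2 hs.2)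
    have h2 : 2 * √(δ * c) * (T - s) ≤ 2 * √(δ * c) * (T - t) :=
      mul_le_mul_of_nonneg_left (by linarith [hs.1]) (by positivity)
    constructor
    · simp only [θ]; linarith [Real.pi_pos]
    · simp only [θ]; linarith
  have hβd : ∀ s ∈ O, HasDerivAt β (-(4 * c + δ * β s ^ 2)) s := fun s hs => by
    have := hasDerivAt_riccati_tan (A := A) (T := T) hc hδ (Real.cos_pos_of_mem_Ioo hs).ne'
    rwa [← hβ s, ← funext hβ] at this
  have hμd : ∀ s ∈ Set.Icc t T,
      HasDerivAt μ (-(2 * c + (1 / 2) * β s * (σM * σMᵀ).trace)) s := fun s hs => by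
    rw [funext hμ]
    refine (hasDerivAt_integral_left hO hs.2 (fun r hr => ?_)
      ((Set.Icc_subset_Icc_left hs.1).trans hIcc)).const_add _
    exact continuousAt_const.add
      ((continuousAt_const.mul (hβd r hr).continuousAt).mul continuousAt_const)
  have hzd : ∀ x : Euc n, ∀ s ∈ Set.Icc t T, HasDerivAt (fun r => z r x)
      (-(4 * c + δ * β s ^ 2) * ‖x‖ ^ 2 / 2 +
        -(2 * c + (1 / 2) * β s * (σM * σMᵀ).trace)) s := fun x s hs => by
    simp only [hz]
    exact (((hβd s (hIcc hs)).mul_const _).div_const 2).add (hμd s hs)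
  have hz' : ∀ s, z s = fun x => β s * ‖x‖ ^ 2 / 2 + μ s := fun s => funext (hz s)
  have hzC2 : ∀ s, ContDiff ℝ 2 (z s) := fun s => by
    rw [hz']
    exact contDiff_quadratic _ _
  have hzcont : ContinuousOn (fun p : ℝ × Euc n => z p.1 p.2) (Set.Icc t T ×ˢ Set.univ) := by
    have hfst : Set.MapsTo Prod.fst (Set.Icc t T ×ˢ (Set.univ : Set (Euc n))) (Set.Icc t T) :=
      fun p hp => hp.1
    have hb : ContinuousOn β (Set.Icc t T) := fun s hs =>
      (hβd s (hIcc hs)).continuousAt.continuousWithinAt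
    have hm : ContinuousOn μ (Set.Icc t T) := fun s hs =>
      (hμd s hs).continuousAt.continuousWithinAt
    simp only [hz]
    exact (((hb.comp continuousOn_fst hfst).mul (by fun_prop)).div_const 2).add
      (hm.comp continuousOn_fst hfst)
  have hβT : β T = 4 * cT := by
    have h1 : √(c / δ) * √(δ / c) = 1 := by
      rw [← Real.sqrt_mul (by positivity), show c / δ * (δ / c) = 1 by field_simp, Real.sqrt_one]
    rw [hβ, sub_self, mul_zero, add_zero, hA, Real.tan_arctan]
    linear_combination 4 * cT * h1
  intro s hs x
  refine sub_nonpos.1 (nonpos_of_parabolic_subsolution σM (w := fun s x => U s x - z s x)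
    (hcont.sub hzcont)
    (fun x s hs => (hdiff x s hs).sub (hzd x s (Set.Ico_subset_Icc_self hs)).differentiableAt)
    (fun s hs => (hC2 s hs).sub (hzC2 s)) ?_ ?_ hinf s hs x)
  · intro s hs x hcrit
    have hs' := Set.Ico_subset_Icc_self hs
    have hUd : DifferentiableAt ℝ (U s) x := (hC2 s hs).differentiable (by norm_num) x
    have hzf : HasFDerivAt (z s) (β s • innerSL ℝ x) x := by
      rw [hz']
      exact hasFDerivAt_quadratic _ _ x
    have hUf : fderiv ℝ (U s) x = β s • innerSL ℝ x := by
      rw [fderiv_fun_sub hUd hzf.differentiableAt, hzf.fderiv] at hcrit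
      exact sub_eq_zero.1 hcrit
    have hgrad : ‖gradient (U s) x‖ ^ 2 = β s ^ 2 * ‖x‖ ^ 2 := by
      rw [gradient, LinearIsometryEquiv.norm_map, hUf, norm_smul, innerSL_apply_norm, mul_pow,
        Real.norm_eq_abs, sq_abs]
    have hder : deriv (fun r => U r x - z r x) s = deriv (fun r => U r x) s -
        (-(4 * c + δ * β s ^ 2) * ‖x‖ ^ 2 / 2 +
          -(2 * c + (1 / 2) * β s * (σM * σMᵀ).trace)) :=
      ((hdiff x s hs).hasDerivAt.sub (hzd x s hs')).deriv
    have hop : opA n (σM * σMᵀ) (z s) x = -(1 / 2) * (β s * (σM * σMᵀ).trace) := by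
      rw [hz']
      exact opA_quadratic _ _ _ x
    have := hsub s hs x
    rw [hgrad] at this
    rw [hder, opA_sub _ (hC2 s hs) (hzC2 s), hop]
    linarith
  · intro x
    have := hterm x
    have h1 : z T x = 2 * cT * (1 + ‖x‖ ^ 2) := by
      rw [hz, hβT, hμ, intervalIntegral.integral_same]
      ring
    simp only [h1]
    linarith

/-- **Proposition 5.1.** Comparison (a priori) estimate `−z ≤ V ≤ z` for a
solution of the HJB equation with quadratically growing data, under the smallness
condition on `T − t` and the stated conditions at infinity. -/
theorem hjb_a_priori_estimate
    (n : ℕ) (hn : 1 ≤ n) (σM : Matrix (Fin n) (Fin n) ℝ) (hσ : IsUnit σM.det)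
    (a : Matrix (Fin n) (Fin n) ℝ) (ha : a = σM * σMᵀ)
    (c cT δ t T : ℝ) (hc : 0 < c) (hcT : 0 < cT) (hδ : 0 < δ) (htT : t < T)
    (hsmall : arctan (2 * cT * Real.sqrt (δ / c)) + (T - t) * (2 * Real.sqrt (δ * c)) < π / 2)
    -- the majorant z
    (β μ : ℝ → ℝ) (z : ℝ → Euc n → ℝ)
    (hβ : ∀ s, β s = 2 * Real.sqrt (c / δ) *
      Real.tan (arctan (2 * cT * Real.sqrt (δ / c)) + 2 * Real.sqrt (δ * c) * (T - s)))
    (hμ : ∀ s, μ s = 2 * cT + ∫ τ in s..T, (2 * c + (1 / 2) * β τ * a.trace))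
    (hz : ∀ s x, z s x = β s * ‖x‖ ^ 2 / 2 + μ s)
    -- the data
    (H : ℝ → Euc n → Euc n → ℝ) (f : ℝ → Euc n → ℝ) (h fT : Euc n → ℝ)
    (hH : ∀ s ∈ Set.Icc t T, ∀ x p : Euc n, |H s x p| ≤ c * (1 + ‖x‖ ^ 2) + δ / 2 * ‖p‖ ^ 2)
    (hf : ∀ s ∈ Set.Icc t T, ∀ x : Euc n, |f s x| ≤ c * (1 + ‖x‖ ^ 2))
    (hh : ∀ x : Euc n, |h x| ≤ cT * (1 + ‖x‖ ^ 2))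
    (hfT : ∀ x : Euc n, |fT x| ≤ cT * (1 + ‖x‖ ^ 2))
    -- the solution V : continuous, C¹ in s, C² in x on [t,T)×ℝⁿ
    (V : ℝ → Euc n → ℝ)
    (hVcont : ContinuousOn (fun p : ℝ × Euc n => V p.1 p.2) (Set.Icc t T ×ˢ Set.univ))
    (hVt : ∀ x : Euc n, ∀ s ∈ Set.Ico t T, DifferentiableAt ℝ (fun σ' => V σ' x) s)
    (hVx : ∀ s ∈ Set.Ico t T, ContDiff ℝ 2 (V s))
    -- the HJB equation
    (hPDE : ∀ s ∈ Set.Ico t T, ∀ x : Euc n,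
      -(deriv (fun σ' => V σ' x) s) + opA n a (V s) x = H s x (gradient (V s) x) + f s x)
    (hterm : ∀ x : Euc n, V T x = h x + fT x)
    -- conditions at infinity
    (hupper : ∀ ε > (0 : ℝ), ∃ R : ℝ, ∀ s ∈ Set.Icc t T, ∀ x : Euc n, R ≤ ‖x‖ →
      V s x - z s x ≤ ε)
    (hlower : ∀ ε > (0 : ℝ), ∃ R : ℝ, ∀ s ∈ Set.Icc t T, ∀ x : Euc n, R ≤ ‖x‖ →
      -ε ≤ V s x + z s x) :
    ∀ s ∈ Set.Icc t T, ∀ x : Euc n, -z s x ≤ V s x ∧ V s x ≤ z s x := by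
  subst ha
  have hbound : ∀ s ∈ Set.Ico t T, ∀ x : Euc n, |H s x (gradient (V s) x) + f s x| ≤
      2 * c * (1 + ‖x‖ ^ 2) + δ / 2 * ‖gradient (V s) x‖ ^ 2 := fun s hs x => by
    have hs' := Set.Ico_subset_Icc_self hs
    linarith [abs_add_le (H s x (gradient (V s) x)) (f s x), hH s hs' x (gradient (V s) x),
      hf s hs' x]
  have hbT : ∀ x : Euc n, |V T x| ≤ 2 * cT * (1 + ‖x‖ ^ 2) := fun x => by
    rw [hterm]
    linarith [abs_add_le (h x) (fT x), hh x, hfT x]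
  intro s hs x
  constructor
  · refine neg_le.1 (subsolution_le_majorant σM hc hcT hδ hsmall hβ hμ hz
      (U := fun s x => -V s x) hVcont.neg (fun x s hs => (hVt x s hs).neg)
      (fun s hs => (hVx s hs).neg) ?_ (fun x => (neg_le_abs _).trans (hbT x)) ?_ s hs x)
    · intro s hs x
      have hgrad : ‖gradient (fun y => -V s y) x‖ = ‖gradient (V s) x‖ := by
        simp only [gradient, LinearIsometryEquiv.norm_map, fderiv_fun_neg, norm_neg]
      have hder : deriv (fun r => -V r x) s = -deriv (fun r => V r x) s :=
        (hVt x s hs).hasDerivAt.neg.deriv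
      rw [hgrad, opA_neg, hder]
      linarith [neg_le_abs (H s x (gradient (V s) x) + f s x), hbound s hs x, hPDE s hs x]
    · intro ε hε
      obtain ⟨R, hR⟩ := hlower ε hε
      exact ⟨R, fun s hs x hx => by linarith [hR s hs x hx]⟩
  · exact subsolution_le_majorant σM hc hcT hδ hsmall hβ hμ hz hVcont hVt hVx
      (fun s hs x => (hPDE s hs x).trans_le ((le_abs_self _).trans (hbound s hs x)))
      (fun x => (le_abs_self _).trans (hbT x)) hupper s hs x

end
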